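/- Let A be a residually solvable group, C a subgroup of A, and φ : A → A a group automorphism. Let G = A ∗_{C = φ(C)} A be the double of A over C via φ. Then G is an extension of a free group by a residually solvable group: there exists a normal subgroup K of G such that K is a free group and the quotient G/K is residually solvable (indeed G/K is isomorphic to A). -/

import Mathlib

open scoped Pointwise

/-- The two maps `C →* A` defining the double `D = A ∗_{C = φ(C)} A`: the first copy of `A`
receives `C` by inclusion, the second copy receives `C` via `φ` followed by inclusion. -/
def doubleMaps {A : Type*} [Group A] (C : Subgroup A) (φ : A ≃* A) :
    Bool → (↥C →* A) :=
  fun b => match b with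
  | false => C.subtype
  | true => (φ : A →* A).comp C.subtype

/-- The double `A ∗_{C = φ(C)} A`: the amalgamated free product (pushout) of two copies of `A`
over `C`, amalgamating `C` in the first copy with `φ(C)` in the second copy via `φ`. -/
abbrev Double {A : Type*} [Group A] (C : Subgroup A) (φ : A ≃* A) : Type _ :=
  Monoid.PushoutI (doubleMaps C φ)

/-- The canonical embedding of the first copy of `A` into the double. -/
def Double.inl {A : Type*} [Group A] (C : Subgroup A) (φ : A ≃* A) : A →* Double C φ :=
  Monoid.PushoutI.of (φ := doubleMaps C φ) false

/-- The canonical embedding of the second copy of `A` into the double. -/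
def Double.inr {A : Type*} [Group A] (C : Subgroup A) (φ : A ≃* A) : A →* Double C φ :=
  Monoid.PushoutI.of (φ := doubleMaps C φ) true

/-- A group is residually solvable if every nontrivial element survives in some solvable
homomorphic image. -/
def ResiduallySolvable (G : Type u) [Group G] : Prop :=
  ∀ g : G, g ≠ 1 → ∃ (S : Type u) (_ : Group S) (f : G →* S), IsSolvable S ∧ f g ≠ 1

section PointedAction

variable {G α : Type*} [Group G] [MulAction G α] (o : α)

open Classical in
/-- The tautological map from a pointed set to the free group on the complement of the basepoint,
sending the basepoint to `1`. -/
noncomputable def pointedOf (x : α) : FreeGroup {x : α // x ≠ o} :=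
  if h : x = o then 1 else FreeGroup.of ⟨x, h⟩

@[simp]
lemma pointedOf_base : pointedOf o o = 1 := by simp [pointedOf]

lemma pointedOf_coe (x : {x : α // x ≠ o}) : pointedOf o x = FreeGroup.of x := by
  simp [pointedOf, x.2]

/-- A map out of a pointed set which sends the basepoint to `1` extends along `pointedOf`. -/
lemma lift_pointedOf {K : Type*} [Group K] (f : α → K) (hf : f o = 1) (x : α) :
    FreeGroup.lift (fun y : {x : α // x ≠ o} => f y) (pointedOf o x) = f x := by
  by_cases h : x = o
  · subst h; simp [hf]
  · simp [pointedOf, h]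

/-- The endomorphism `x ↦ (g • x) (g • o)⁻¹` of the free group on a pointed set. -/
noncomputable def pointedTwist (g : G) :
    FreeGroup {x : α // x ≠ o} →* FreeGroup {x : α // x ≠ o} :=
  FreeGroup.lift fun x => pointedOf o (g • (x : α)) * (pointedOf o (g • o))⁻¹

lemma pointedTwist_pointedOf (g : G) (x : α) :
    pointedTwist o g (pointedOf o x) = pointedOf o (g • x) * (pointedOf o (g • o))⁻¹ :=
  lift_pointedOf o (fun x => pointedOf o (g • x) * (pointedOf o (g • o))⁻¹) (by simp) x

lemma pointed_hom_ext {K : Type*} [Group K] {f f' : FreeGroup {x : α // x ≠ o} →* K}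
    (h : ∀ x, f (pointedOf o x) = f' (pointedOf o x)) : f = f' := by
  ext x
  simpa [pointedOf_coe] using h x

lemma pointedTwist_one : pointedTwist o (1 : G) = MonoidHom.id _ :=
  pointed_hom_ext o fun x => by simp [pointedTwist_pointedOf]

lemma pointedTwist_mul (g h : G) :
    pointedTwist o (g * h) = (pointedTwist o g).comp (pointedTwist o h) :=
  pointed_hom_ext o fun x => by simp [pointedTwist_pointedOf, mul_smul]

/-- The action of `G` on the free group on a pointed `G`-set by `x ↦ (g • x) (g • o)⁻¹`. -/
noncomputable def pointedAut : G →* MulAut (FreeGroup {x : α // x ≠ o}) where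
  toFun g := MonoidHom.toMulEquiv (pointedTwist o g) (pointedTwist o g⁻¹)
    (by rw [← pointedTwist_mul, inv_mul_cancel, pointedTwist_one])
    (by rw [← pointedTwist_mul, mul_inv_cancel, pointedTwist_one])
  map_one' := by
    ext x
    exact DFunLike.congr_fun (pointedTwist_one (G := G) o) x
  map_mul' g h := by
    ext x
    exact DFunLike.congr_fun (pointedTwist_mul o g h) x

lemma pointedAut_pointedOf (g : G) (x : α) :
    pointedAut o g (pointedOf o x) = pointedOf o (g • x) * (pointedOf o (g • o))⁻¹ :=
  pointedTwist_pointedOf o g x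

/-- The homomorphism `g ↦ (g • o)⁻¹ g` into the semidirect product attached to `pointedAut`. -/
noncomputable def pointedSection :
    G →* FreeGroup {x : α // x ≠ o} ⋊[pointedAut (G := G) o] G where
  toFun g := ⟨(pointedOf o (g • o))⁻¹, g⟩
  map_one' := by ext <;> simp
  map_mul' g h := by ext <;> simp [pointedAut_pointedOf, mul_smul]

end PointedAction

namespace Double

variable {A : Type*} [Group A] (C : Subgroup A) (φ : A ≃* A)

/-- The semidirect product which turns out to be isomorphic to the double of `A` over `C`. -/
abbrev Model : Type _ :=
  FreeGroup {x : A ⧸ C // x ≠ ((1 : A) : A ⧸ C)} ⋊[pointedAut (G := A) ((1 : A) : A ⧸ C)] A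

lemma inl_coe (c : C) : inl C φ c = inr C φ (φ c) :=
  (Monoid.PushoutI.of_apply_eq_base (doubleMaps C φ) false c).trans
    (Monoid.PushoutI.of_apply_eq_base (doubleMaps C φ) true c).symm

lemma hom_ext {K : Type*} [Group K] {f f' : Double C φ →* K}
    (h₁ : ∀ a, f (inl C φ a) = f' (inl C φ a))
    (h₂ : ∀ a, f (inr C φ (φ a)) = f' (inr C φ (φ a))) : f = f' := by
  refine Monoid.PushoutI.hom_ext_nonempty fun b => ?_
  cases b
  · exact MonoidHom.ext h₁
  · refine MonoidHom.ext fun a => ?_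
    have h := h₂ (φ.symm a)
    rwa [φ.apply_symm_apply] at h

lemma coe_coe_eq_base (c : C) : ((c : A) : A ⧸ C) = ((1 : A) : A ⧸ C) := by
  simp [QuotientGroup.eq]

/-- The two maps from `A` to the semidirect product, assembled to a family indexed by `Bool`. -/
noncomputable def modelMaps : Bool → (A →* Model C)
  | false => SemidirectProduct.inr
  | true => (pointedSection ((1 : A) : A ⧸ C)).comp (φ.symm : A →* A)

/-- The homomorphism from the double to the semidirect product. -/
noncomputable def toModel : Double C φ →* Model C :=
  Monoid.PushoutI.lift (modelMaps C φ) (SemidirectProduct.inr.comp C.subtype) <| by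
    rintro (_ | _)
    · rfl
    · ext c <;> simp [modelMaps, doubleMaps, pointedSection, coe_coe_eq_base]

lemma toModel_inl (a : A) : toModel C φ (inl C φ a) = SemidirectProduct.inr a :=
  Monoid.PushoutI.lift_of _ _ _ _

lemma toModel_inr (a : A) : toModel C φ (inr C φ (φ a)) = pointedSection ((1 : A) : A ⧸ C) a :=
  (Monoid.PushoutI.lift_of _ _ _ _).trans (by simp [modelMaps])

/-- The element `a a'⁻¹` of the double, where `a'` is the copy of `a` in the second factor;
it depends only on the coset `a C`. -/
def diff : A ⧸ C → Double C φ :=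
  Quotient.lift (fun a => inl C φ a * (inr C φ (φ a))⁻¹) fun a b h => by
    obtain ⟨c, rfl⟩ : ∃ c : C, b = a * c :=
      ⟨⟨a⁻¹ * b, QuotientGroup.leftRel_apply.mp h⟩, by simp⟩
    simp [inl_coe]

lemma diff_coe (a : A) : diff C φ (a : A ⧸ C) = inl C φ a * (inr C φ (φ a))⁻¹ := rfl

/-- The homomorphism from the free group to the double sending the coset `a C` to `a a'⁻¹`. -/
noncomputable def freeToDouble :
    FreeGroup {x : A ⧸ C // x ≠ ((1 : A) : A ⧸ C)} →* Double C φ :=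
  FreeGroup.lift fun x => diff C φ x

lemma freeToDouble_pointedOf (a : A) :
    freeToDouble C φ (pointedOf ((1 : A) : A ⧸ C) a) = inl C φ a * (inr C φ (φ a))⁻¹ :=
  lift_pointedOf _ (diff C φ) (by simp [diff_coe]) _

/-- The homomorphism from the semidirect product to the double. -/
noncomputable def ofModel : Model C →* Double C φ :=
  SemidirectProduct.lift (freeToDouble C φ) (inl C φ) fun a => by
    refine pointed_hom_ext _ fun x => ?_
    obtain ⟨b, rfl⟩ := QuotientGroup.mk_surjective x
    simp [pointedAut_pointedOf, freeToDouble_pointedOf, mul_assoc]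

/-- The double of `A` over `C` is a semidirect product of a free group and `A`. -/
noncomputable def equivModel : Double C φ ≃* Model C :=
  MonoidHom.toMulEquiv (toModel C φ) (ofModel C φ)
    (hom_ext C φ (fun a => by simp [toModel_inl, ofModel]) fun a => by
      simp [toModel_inr, ofModel, pointedSection, SemidirectProduct.lift,
        freeToDouble_pointedOf])
    (SemidirectProduct.hom_ext
      (pointed_hom_ext _ fun x => by
        obtain ⟨b, rfl⟩ := QuotientGroup.mk_surjective x
        ext <;> simp [ofModel, freeToDouble_pointedOf, toModel_inl, toModel_inr, pointedSection])
      (MonoidHom.ext fun a => by simp [toModel_inl, ofModel]))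

end Double

lemma ResiduallySolvable.of_injective {G H : Type u} [Group G] [Group H]
    (hH : ResiduallySolvable H) (f : G →* H) (hf : Function.Injective f) :
    ResiduallySolvable G := fun g hg => by
  obtain ⟨S, _, k, hS, hk⟩ := hH (f g) ((map_ne_one_iff f hf).mpr hg)
  exact ⟨S, _, k.comp f, hS, hk⟩

/-- The kernel of the projection from a semidirect product with free left factor is free. -/
lemma SemidirectProduct.isFreeGroup_ker_rightHom {N H : Type*} [Group N] [Group H]
    [IsFreeGroup N] (θ : H →* MulAut N) :
    IsFreeGroup (SemidirectProduct.rightHom : N ⋊[θ] H →* H).ker :=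
  IsFreeGroup.ofMulEquiv ((MonoidHom.ofInjective (SemidirectProduct.inl_injective (φ := θ))).trans
    (MulEquiv.subgroupCongr SemidirectProduct.range_inl_eq_ker_rightHom))

/-- **Proposition (easydouble).** If `A` is residually solvable, then the double
`G = A ∗_{C = φ(C)} A` is an extension of a free group by a residually solvable group:
there is a normal subgroup `K` of `G` which is free and such that `G/K` is residually
solvable (indeed `G/K ≃ A`). -/
theorem double_free_by_residually_solvable {A : Type u} [Group A]
    (hA : ResiduallySolvable A) (C : Subgroup A) (φ : A ≃* A) :
    ∃ K : Subgroup (Double C φ), ∃ _ : K.Normal,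
      IsFreeGroup K ∧ ResiduallySolvable (Double C φ ⧸ K) ∧
      Nonempty ((Double C φ ⧸ K) ≃* A) := by
  let e := Double.equivModel C φ
  let f : Double C φ →* A := SemidirectProduct.rightHom.comp e.toMonoidHom
  have hf : Function.Surjective f := SemidirectProduct.rightHom_surjective.comp e.surjective
  let q := QuotientGroup.quotientKerEquivOfSurjective f hf
  refine ⟨f.ker, inferInstance, ?_, hA.of_injective q.toMonoidHom q.injective, ⟨q⟩⟩
  have := SemidirectProduct.isFreeGroup_ker_rightHom (pointedAut (G := A) ((1 : A) : A ⧸ C))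
  have h : f.ker.map e.toMonoidHom = SemidirectProduct.rightHom.ker := by
    rw [← MonoidHom.comap_ker]
    exact Subgroup.map_comap_eq_self_of_surjective e.surjective _
  exact IsFreeGroup.ofMulEquiv ((e.subgroupMap f.ker).trans (MulEquiv.subgroupCongr h)).symm
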